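/- (Rademacher generalization bound.) Let (Z, 𝒜) be a measurable space with probability measure μ, let n ≥ 1, and let G be a nonempty countable family of measurable functions g : Z → [0, 1]. Then for every δ ∈ (0, 1), with probability at least 1 − δ over an i.i.d. sample z = (z₁, …, zₙ) drawn from μ^⊗n, the following holds simultaneously for all g ∈ G: E_{z∼μ}[g(z)] ≤ (1/n)·Σ_{i=1}^{n} g(zᵢ) + 2·R̂(G(z)) + 3·√(log(2/δ)/(2n)), where G(z) = { (g(z₁), …, g(zₙ)) : g ∈ G } ⊆ ℝⁿ. -/

import Mathlib

open MeasureTheory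

/-- The empirical Rademacher complexity of a set `S ⊆ ℝⁿ`:
`R̂(S) = 2^{-n} Σ_{σ ∈ {-1,1}ⁿ} sup_{v ∈ S} (1/n) Σ_i σ_i v_i`. -/
noncomputable def empRad {n : ℕ} (S : Set (Fin n → ℝ)) : ℝ :=
  (1 / 2 ^ n) * ∑ ε : Fin n → Bool,
    sSup ((fun v : Fin n → ℝ =>
      (1 / (n : ℝ)) * ∑ i, (if ε i then (1 : ℝ) else -1) * v i) '' S)

open ProbabilityTheory

lemma integrable_of_measurable_of_abs_le {Ω : Type*} [MeasurableSpace Ω] {P : Measure Ω}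
    [IsFiniteMeasure P] {f : Ω → ℝ} (hf : Measurable f) {B : ℝ} (hB : ∀ x, |f x| ≤ B) :
    Integrable f P :=
  .of_bound hf.aestronglyMeasurable B (.of_forall hB)

lemma abs_sub_le_one_of_mem_Icc {a b : ℝ} (ha : a ∈ Set.Icc (0 : ℝ) 1)
    (hb : b ∈ Set.Icc (0 : ℝ) 1) : |a - b| ≤ 1 :=
  abs_le.mpr ⟨by linarith [ha.1, hb.2], by linarith [ha.2, hb.1]⟩

lemma integral_mem_Icc_of_forall_mem_Icc {Ω : Type*} [MeasurableSpace Ω] (P : Measure Ω)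
    [IsProbabilityMeasure P] {f : Ω → ℝ} (hf : Measurable f) {a b : ℝ}
    (hab : ∀ x, f x ∈ Set.Icc a b) : ∫ x, f x ∂P ∈ Set.Icc a b := by
  have hfi : Integrable f P := .of_mem_Icc a b hf.aemeasurable (.of_forall hab)
  constructor
  · simpa using integral_mono (integrable_const a) hfi fun x ↦ (hab x).1
  · simpa using integral_mono hfi (integrable_const b) fun x ↦ (hab x).2

/-- **Hoeffding's lemma** for a function whose oscillation is at most `c`. -/
lemma integral_exp_sub_integral_le_of_forall_le_add {Z : Type*} [MeasurableSpace Z]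
    (μ : Measure Z) [IsProbabilityMeasure μ] {f : Z → ℝ} (hf : Measurable f) {B c : ℝ}
    (hB : ∀ x, |f x| ≤ B) (hc : ∀ x y, f y ≤ f x + c) (t : ℝ) :
    ∫ x, Real.exp (t * (f x - ∫ y, f y ∂μ)) ∂μ ≤ Real.exp (c ^ 2 * t ^ 2 / 8) := by
  have : Nonempty Z := nonempty_of_isProbabilityMeasure μ
  have hbdd : BddBelow (Set.range f) := ⟨-B, by rintro _ ⟨x, rfl⟩; exact (abs_le.mp (hB x)).1⟩
  have hsub : HasSubgaussianMGF (fun x ↦ f x - ∫ y, f y ∂μ)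
      ((‖(⨅ x, f x) + c - ⨅ x, f x‖₊ / 2) ^ 2) μ := by
    refine hasSubgaussianMGF_of_mem_Icc hf.aemeasurable (.of_forall fun y ↦ ⟨ciInf_le hbdd y, ?_⟩)
    have := le_ciInf fun x ↦ sub_le_iff_le_add.mpr (hc x y)
    linarith
  refine (hsub.mgf_le t).trans (Real.exp_le_exp.mpr (le_of_eq ?_))
  simp only [add_sub_cancel_left, NNReal.coe_pow, NNReal.coe_div, coe_nnnorm, Real.norm_eq_abs,
    div_pow, sq_abs, NNReal.coe_ofNat]
  ring

lemma integral_pi_succ {Z : Type*} [MeasurableSpace Z] (μ : Measure Z) [IsProbabilityMeasure μ]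
    {n : ℕ} {f : (Fin (n + 1) → Z) → ℝ} (hf : Measurable f) {B : ℝ} (hB : ∀ z, |f z| ≤ B) :
    ∫ z, f z ∂(Measure.pi fun _ ↦ μ)
      = ∫ w, ∫ x, f (Fin.cons x w) ∂μ ∂(Measure.pi fun _ : Fin n ↦ μ) := by
  have hmp := (measurePreserving_piFinSuccAbove (fun _ : Fin (n + 1) ↦ μ) 0).symm
  rw [← hmp.integral_comp', integral_prod_symm]
  · simp [MeasurableEquiv.piFinSuccAbove_symm_apply, Fin.insertNthEquiv]
  · exact integrable_of_measurable_of_abs_le (hf.comp (MeasurableEquiv.measurable _))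
      fun _ ↦ hB _

lemma measurable_finCons {Z : Type*} [MeasurableSpace Z] {n : ℕ} :
    Measurable fun p : Z × (Fin n → Z) ↦ (Fin.cons p.1 p.2 : Fin (n + 1) → Z) := by
  refine measurable_pi_lambda _ fun i ↦ ?_
  cases i using Fin.cases with
  | zero => simpa using measurable_fst
  | succ i => simpa [Function.comp_def] using (measurable_pi_apply i).comp measurable_snd

/-- The moment generating function bound behind **McDiarmid's inequality**. -/
lemma integral_exp_sub_integral_le_of_boundedDifferences {Z : Type*} [MeasurableSpace Z]
    (μ : Measure Z) [IsProbabilityMeasure μ] {B c : ℝ} (t : ℝ) {n : ℕ} {f : (Fin n → Z) → ℝ}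
    (hf : Measurable f) (hB : ∀ z, |f z| ≤ B)
    (hc : ∀ z i y, f (Function.update z i y) ≤ f z + c) :
    ∫ z, Real.exp (t * (f z - ∫ w, f w ∂(Measure.pi fun _ ↦ μ))) ∂(Measure.pi fun _ ↦ μ)
      ≤ Real.exp (n * (c ^ 2 * t ^ 2 / 8)) := by
  induction n with
  | zero => simp [integral_unique]
  | succ n ih =>
    have hfc : Measurable fun p : Z × (Fin n → Z) ↦ f (Fin.cons p.1 p.2) :=
      hf.comp measurable_finCons
    have hfx (w) : Measurable fun x ↦ f (Fin.cons x w) :=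
      hfc.comp (measurable_id.prodMk measurable_const)
    have hfx_int (w) : Integrable (fun x ↦ f (Fin.cons x w)) μ :=
      integrable_of_measurable_of_abs_le (hfx w) fun _ ↦ hB _
    set h : (Fin n → Z) → ℝ := fun w ↦ ∫ x, f (Fin.cons x w) ∂μ with h_def
    have hh : Measurable h := hfc.stronglyMeasurable.integral_prod_left'.measurable
    have hhB (w) : |h w| ≤ B := by
      simpa using norm_integral_le_of_norm_le_const (μ := μ) (f := fun x ↦ f (Fin.cons x w))
        (.of_forall fun x ↦ hB _)
    have hhc (w i y) : h (Function.update w i y) ≤ h w + c := by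
      have : h w + c = ∫ x, (f (Fin.cons x w) + c) ∂μ := by
        rw [integral_add (hfx_int w) (integrable_const _)]; simp [h_def]
      rw [this]
      refine integral_mono (hfx_int _) ((hfx_int w).add (integrable_const _)) fun x ↦ ?_
      simpa [Fin.cons_update] using hc (Fin.cons x w) i.succ y
    rw [integral_pi_succ μ hf hB]
    have hexpB {k : ℕ} (u : (Fin k → Z) → ℝ) (hu : ∀ z, |u z| ≤ B) (m : ℝ) (z) :
        |Real.exp (t * (u z - m))| ≤ Real.exp (|t| * (B + |m|)) := by
      rw [Real.abs_exp, Real.exp_le_exp]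
      calc t * (u z - m) ≤ |t| * |u z - m| := by rw [← abs_mul]; exact le_abs_self _
        _ ≤ |t| * (B + |m|) := by gcongr; exact (abs_sub _ _).trans (by gcongr; exact hu z)
    rw [integral_pi_succ μ (by fun_prop) (hexpB f hB _)]
    have hinner (w : Fin n → Z) :
        ∫ x, Real.exp (t * (f (Fin.cons x w) - ∫ w, h w ∂(Measure.pi fun _ ↦ μ))) ∂μ
          ≤ Real.exp (t * (h w - ∫ w, h w ∂(Measure.pi fun _ ↦ μ)))
            * Real.exp (c ^ 2 * t ^ 2 / 8) := by
      have key := integral_exp_sub_integral_le_of_forall_le_add μ (hfx w) (c := c)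
        (fun x ↦ hB _) (fun x y ↦ by simpa using hc (Fin.cons x w) 0 y) t
      change ∫ x, Real.exp (t * (f (Fin.cons x w) - h w)) ∂μ ≤ _ at key
      refine le_trans (le_of_eq ?_) (mul_le_mul_of_nonneg_left key (Real.exp_pos _).le)
      rw [← integral_const_mul]
      refine integral_congr_ae (.of_forall fun x ↦ ?_)
      simp only [← Real.exp_add]
      ring_nf
    have hint : Integrable (fun w ↦ Real.exp (t * (h w - ∫ w, h w ∂(Measure.pi fun _ ↦ μ))))
        (Measure.pi fun _ ↦ μ) :=
      integrable_of_measurable_of_abs_le (by fun_prop) (hexpB h hhB _)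
    calc _ ≤ ∫ w, Real.exp (t * (h w - ∫ w, h w ∂(Measure.pi fun _ ↦ μ)))
            * Real.exp (c ^ 2 * t ^ 2 / 8) ∂(Measure.pi fun _ ↦ μ) :=
          integral_mono_of_nonneg (.of_forall fun w ↦ integral_nonneg fun x ↦ (Real.exp_pos _).le)
            (hint.mul_const _) (.of_forall hinner)
      _ ≤ Real.exp (n * (c ^ 2 * t ^ 2 / 8)) * Real.exp (c ^ 2 * t ^ 2 / 8) := by
          rw [integral_mul_const]
          gcongr
          exact ih hh hhB hhc
      _ = _ := by rw [← Real.exp_add]; push_cast; ring_nf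

/-- **McDiarmid's inequality** for i.i.d. coordinates and equal difference bounds. -/
lemma measureReal_ge_le_of_boundedDifferences {Z : Type*} [MeasurableSpace Z]
    (μ : Measure Z) [IsProbabilityMeasure μ] {B c : ℝ} {n : ℕ} {f : (Fin n → Z) → ℝ}
    (hf : Measurable f) (hB : ∀ z, |f z| ≤ B)
    (hc : ∀ z i y, f (Function.update z i y) ≤ f z + c) {ε : ℝ} (hε : 0 ≤ ε) :
    (Measure.pi fun _ ↦ μ).real {z | ε ≤ f z - ∫ w, f w ∂(Measure.pi fun _ ↦ μ)}
      ≤ Real.exp (-2 * ε ^ 2 / (n * c ^ 2)) := by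
  have hsub : HasSubgaussianMGF (fun z ↦ f z - ∫ w, f w ∂(Measure.pi fun _ ↦ μ))
      (n * (‖c‖₊ / 2) ^ 2) (Measure.pi fun _ ↦ μ) := by
    refine ⟨fun t ↦ integrable_exp_mul_of_mem_Icc (a := -B - ∫ w, f w ∂(Measure.pi fun _ ↦ μ))
      (b := B - ∫ w, f w ∂(Measure.pi fun _ ↦ μ)) (by fun_prop) (.of_forall fun z ↦ ?_),
      fun t ↦ ?_⟩
    · have := abs_le.mp (hB z)
      constructor <;> linarith
    · refine (integral_exp_sub_integral_le_of_boundedDifferences μ t hf hB hc).trans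
        (Real.exp_le_exp.mpr (le_of_eq ?_))
      simp only [NNReal.coe_mul, NNReal.coe_natCast, NNReal.coe_pow, NNReal.coe_div, coe_nnnorm,
        Real.norm_eq_abs, div_pow, sq_abs, NNReal.coe_ofNat]
      ring
  refine (hsub.measure_ge_le hε).trans (Real.exp_le_exp.mpr (le_of_eq ?_))
  simp only [NNReal.coe_mul, NNReal.coe_natCast, NNReal.coe_pow, NNReal.coe_div, coe_nnnorm,
    Real.norm_eq_abs, div_pow, sq_abs, NNReal.coe_ofNat]
  ring

/-- The supremum over the family `f` of the averages over the sample `z` with weights `w`. -/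
noncomputable def weightedSup {ι Z : Type*} {n : ℕ} (f : ι → Z → ℝ) (w : Fin n → ℝ)
    (z : Fin n → Z) : ℝ :=
  ⨆ k, (1 / (n : ℝ)) * ∑ i, w i * f k (z i)

/-- The real sign encoded by a boolean. -/
def boolSign (b : Bool) : ℝ := if b then 1 else -1

lemma abs_boolSign_le (b : Bool) : |boolSign b| ≤ 1 := by cases b <;> simp [boolSign]

section weightedSup

variable {ι Z : Type*} {n : ℕ} {f : ι → Z → ℝ} {w : Fin n → ℝ}

lemma measurable_weightedSup [MeasurableSpace Z] [Countable ι] (hf : ∀ k, Measurable (f k))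
    (w : Fin n → ℝ) : Measurable (weightedSup f w) :=
  .iSup fun k ↦ (Finset.measurable_fun_sum _ fun i _ ↦
    ((hf k).comp (measurable_pi_apply i)).const_mul _).const_mul _

lemma abs_weightedAverage_le (hf : ∀ k x, |f k x| ≤ 1) (hw : ∀ i, |w i| ≤ 1) (z : Fin n → Z)
    (k : ι) : |(1 / (n : ℝ)) * ∑ i, w i * f k (z i)| ≤ 1 := by
  have hsum : |∑ i, w i * f k (z i)| ≤ n := by
    refine (Finset.abs_sum_le_sum_abs _ _).trans ?_
    refine (Finset.sum_le_card_nsmul _ _ 1 fun i _ ↦ ?_).trans (by simp)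
    rw [abs_mul]
    exact mul_le_one₀ (hw i) (abs_nonneg _) (hf k _)
  rw [abs_mul, abs_of_nonneg (by positivity : (0 : ℝ) ≤ 1 / n), one_div_mul_eq_div]
  exact div_le_one_of_le₀ hsum (by positivity)

lemma bddAbove_weightedAverage (hf : ∀ k x, |f k x| ≤ 1) (hw : ∀ i, |w i| ≤ 1) (z : Fin n → Z) :
    BddAbove (Set.range fun k ↦ (1 / (n : ℝ)) * ∑ i, w i * f k (z i)) :=
  ⟨1, by rintro _ ⟨k, rfl⟩; exact (abs_le.mp (abs_weightedAverage_le hf hw z k)).2⟩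

lemma weightedAverage_le_weightedSup (hf : ∀ k x, |f k x| ≤ 1) (hw : ∀ i, |w i| ≤ 1)
    (z : Fin n → Z) (k : ι) :
    (1 / (n : ℝ)) * ∑ i, w i * f k (z i) ≤ weightedSup f w z :=
  le_ciSup (bddAbove_weightedAverage hf hw z) k

lemma abs_weightedSup_le [Nonempty ι] (hf : ∀ k x, |f k x| ≤ 1) (hw : ∀ i, |w i| ≤ 1)
    (z : Fin n → Z) : |weightedSup f w z| ≤ 1 := by
  obtain ⟨k⟩ := ‹Nonempty ι›
  have : Nonempty ι := ⟨k⟩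
  exact abs_le.mpr ⟨(abs_le.mp (abs_weightedAverage_le hf hw z k)).1.trans
    (weightedAverage_le_weightedSup hf hw z k),
    ciSup_le fun k ↦ (abs_le.mp (abs_weightedAverage_le hf hw z k)).2⟩

lemma weightedSup_update_le [Nonempty ι] (hf : ∀ k x, |f k x| ≤ 1)
    (hosc : ∀ k x y, |f k x - f k y| ≤ 1) (hw : ∀ i, |w i| ≤ 1) (z : Fin n → Z) (i : Fin n)
    (y : Z) : weightedSup f w (Function.update z i y) ≤ weightedSup f w z + 1 / n := by
  refine ciSup_le fun k ↦ ?_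
  have hdiff : ∑ j, w j * f k (Function.update z i y j)
      = ∑ j, w j * f k (z j) + w i * (f k y - f k (z i)) := by
    rw [← sub_eq_iff_eq_add', ← Finset.sum_sub_distrib, Finset.sum_eq_single i]
    · simp; ring
    · intro j _ hj
      simp [hj]
    · simp
  have hle : w i * (f k y - f k (z i)) ≤ 1 := by
    refine (le_abs_self _).trans ?_
    rw [abs_mul]
    exact mul_le_one₀ (hw i) (abs_nonneg _) (hosc k _ _)
  calc (1 / (n : ℝ)) * ∑ j, w j * f k (Function.update z i y j)
      = (1 / (n : ℝ)) * ∑ j, w j * f k (z j) + 1 / n * (w i * (f k y - f k (z i))) := by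
        rw [hdiff, mul_add]
    _ ≤ weightedSup f w z + 1 / n * 1 := by
        gcongr
        exact weightedAverage_le_weightedSup hf hw z k
    _ = _ := by rw [mul_one]

lemma integrable_weightedSup [MeasurableSpace Z] [Countable ι] [Nonempty ι]
    {P : Measure (Fin n → Z)} [IsFiniteMeasure P] (hfm : ∀ k, Measurable (f k))
    (hf : ∀ k x, |f k x| ≤ 1) (hw : ∀ i, |w i| ≤ 1) : Integrable (weightedSup f w) P :=
  integrable_of_measurable_of_abs_le (measurable_weightedSup hfm w) (abs_weightedSup_le hf hw)

end weightedSup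

lemma empRad_image_eq {Z : Type*} {n : ℕ} (G : Set (Z → ℝ)) (z : Fin n → Z) :
    empRad ((fun g : Z → ℝ => fun i : Fin n => g (z i)) '' G)
      = (1 / 2 ^ n) * ∑ ε : Fin n → Bool,
          weightedSup (fun g : G ↦ (g : Z → ℝ)) (fun i ↦ boolSign (ε i)) z := by
  simp only [empRad, Set.image_image, sSup_image', weightedSup, boolSign]

lemma MeasureTheory.MeasurePreserving.integral_comp_of_measurable {α β : Type*}
    [MeasurableSpace α] [MeasurableSpace β] {μ : Measure α} {ν : Measure β} {φ : α → β}
    (hφ : MeasurePreserving φ μ ν) {u : β → ℝ} (hu : Measurable u) :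
    ∫ x, u (φ x) ∂μ = ∫ y, u y ∂ν := by
  rw [← hφ.map_eq, integral_map hφ.measurable.aemeasurable hu.aestronglyMeasurable]

section symmetrization

variable {ι Z : Type*} [Countable ι] [Nonempty ι] [MeasurableSpace Z] {μ : Measure Z}
  [IsProbabilityMeasure μ] {n : ℕ} {g : ι → Z → ℝ}

/-- The expected uniform deviation is at most the one between two independent samples. -/
lemma integral_weightedSup_sub_le_integral_ghost (hgm : ∀ k, Measurable (g k))
    (hg : ∀ k x, g k x ∈ Set.Icc (0 : ℝ) 1) :
    ∫ z, weightedSup (fun k x ↦ ∫ y, g k y ∂μ - g k x) (fun _ ↦ 1) z ∂(Measure.pi fun _ : Fin n ↦ μ)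
      ≤ ∫ q, weightedSup (fun k (p : Z × Z) ↦ g k p.1 - g k p.2) (fun _ ↦ 1) q
          ∂(Measure.pi fun _ : Fin n ↦ μ.prod μ) := by
  have hosc (k) (p : Z × Z) : |g k p.1 - g k p.2| ≤ 1 :=
    abs_sub_le_one_of_mem_Icc (hg k _) (hg k _)
  have hgi (k) : Integrable (g k) μ := .of_mem_Icc 0 1 (hgm k).aemeasurable (.of_forall (hg k))
  have hDm : Measurable (weightedSup (n := n) (fun k (p : Z × Z) ↦ g k p.1 - g k p.2)
      (fun _ ↦ 1)) := measurable_weightedSup (fun k ↦ by fun_prop (disch := exact hgm k)) _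
  have hDb := abs_weightedSup_le (n := n) (w := fun _ ↦ 1) hosc (by simp)
  have hmp := (measurePreserving_arrowProdEquivProdArrow Z Z (Fin n) (fun _ ↦ μ) (fun _ ↦ μ)).symm
  have hDpm : Measurable fun p : (Fin n → Z) × (Fin n → Z) ↦
      weightedSup (fun k (p : Z × Z) ↦ g k p.1 - g k p.2) (fun _ ↦ 1)
        (fun i ↦ (p.1 i, p.2 i)) := hDm.comp (by fun_prop)
  have hDpi : Integrable (fun p : (Fin n → Z) × (Fin n → Z) ↦
      weightedSup (fun k (p : Z × Z) ↦ g k p.1 - g k p.2) (fun _ ↦ 1)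
        (fun i ↦ (p.1 i, p.2 i))) ((Measure.pi fun _ ↦ μ).prod (Measure.pi fun _ ↦ μ)) :=
    integrable_of_measurable_of_abs_le hDpm fun _ ↦ hDb _
  rw [← hmp.integral_comp_of_measurable hDm]
  change _ ≤ ∫ p : (Fin n → Z) × (Fin n → Z),
    weightedSup (fun k (p : Z × Z) ↦ g k p.1 - g k p.2) (fun _ ↦ 1) (fun i ↦ (p.1 i, p.2 i)) ∂_
  rw [integral_prod_symm _ hDpi]
  refine integral_mono (integrable_weightedSup (fun k ↦ (hgm k).const_sub _) (fun k x ↦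
    abs_sub_le_one_of_mem_Icc (integral_mem_Icc_of_forall_mem_Icc μ (hgm k) (hg k)) (hg k x))
    (by simp)) hDpi.integral_prod_right fun z ↦ ciSup_le fun k ↦ ?_
  have hcoord (i : Fin n) : Integrable (fun z' : Fin n → Z ↦ g k (z' i)) (Measure.pi fun _ ↦ μ) :=
    (measurePreserving_eval (fun _ : Fin n ↦ μ) i).integrable_comp_of_integrable (hgi k)
  have hdiff (i : Fin n) : Integrable (fun z' : Fin n → Z ↦ 1 * (g k (z' i) - g k (z i)))
      (Measure.pi fun _ ↦ μ) := ((hcoord i).sub (integrable_const _)).const_mul 1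
  have hmean : (1 / (n : ℝ)) * ∑ i, 1 * (∫ y, g k y ∂μ - g k (z i))
      = ∫ z' : Fin n → Z, (1 / (n : ℝ)) * ∑ i, 1 * (g k (z' i) - g k (z i))
          ∂(Measure.pi fun _ ↦ μ) := by
    rw [integral_const_mul, integral_finsetSum _ fun i _ ↦ hdiff i]
    congr 1
    refine Finset.sum_congr rfl fun i _ ↦ ?_
    rw [integral_const_mul, integral_sub (hcoord i) (integrable_const _),
      (measurePreserving_eval (fun _ : Fin n ↦ μ) i).integral_comp_of_measurable (hgm k)]
    simp
  rw [hmean]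
  refine integral_mono ((integrable_finsetSum _ fun i _ ↦ hdiff i).const_mul _)
    (integrable_of_measurable_of_abs_le (hDpm.comp (measurable_id.prodMk measurable_const))
      fun _ ↦ hDb _) fun z' ↦ ?_
  exact weightedAverage_le_weightedSup hosc (by simp) (fun i ↦ (z' i, z i)) k

/-- Swapping the two samples at some coordinates does not change the expected deviation. -/
lemma integral_ghost_le_add (hgm : ∀ k, Measurable (g k))
    (hg : ∀ k x, g k x ∈ Set.Icc (0 : ℝ) 1) (ε : Fin n → Bool) :
    ∫ q, weightedSup (fun k (p : Z × Z) ↦ g k p.1 - g k p.2) (fun _ ↦ 1) q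
        ∂(Measure.pi fun _ : Fin n ↦ μ.prod μ)
      ≤ ∫ z, weightedSup g (fun i ↦ boolSign (ε i)) z ∂(Measure.pi fun _ ↦ μ)
        + ∫ z, weightedSup g (fun i ↦ boolSign (!ε i)) z ∂(Measure.pi fun _ ↦ μ) := by
  have hg' (k x) : |g k x| ≤ 1 := by
    rw [abs_of_nonneg (hg k x).1]; exact (hg k x).2
  have hosc (k) (p : Z × Z) : |g k p.1 - g k p.2| ≤ 1 :=
    abs_sub_le_one_of_mem_Icc (hg k _) (hg k _)
  have hDm (w : Fin n → ℝ) : Measurable (weightedSup (fun k (p : Z × Z) ↦ g k p.1 - g k p.2) w) :=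
    measurable_weightedSup (fun k ↦ by fun_prop (disch := exact hgm k)) _
  have hswap : MeasurePreserving
      (fun (q : Fin n → Z × Z) i ↦ (bif ε i then id else Prod.swap) (q i))
      (Measure.pi fun _ ↦ μ.prod μ) (Measure.pi fun _ ↦ μ.prod μ) := by
    refine measurePreserving_pi _ _ fun i ↦ ?_
    cases ε i
    · exact Measure.measurePreserving_swap
    · exact .id _
  have hfst : MeasurePreserving (fun (q : Fin n → Z × Z) i ↦ (q i).1)
      (Measure.pi fun _ ↦ μ.prod μ) (Measure.pi fun _ ↦ μ) :=
    measurePreserving_pi _ _ fun _ ↦ measurePreserving_fst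
  have hsnd : MeasurePreserving (fun (q : Fin n → Z × Z) i ↦ (q i).2)
      (Measure.pi fun _ ↦ μ.prod μ) (Measure.pi fun _ ↦ μ) :=
    measurePreserving_pi _ _ fun _ ↦ measurePreserving_snd
  have hA (ε : Fin n → Bool) : Integrable (weightedSup g fun i ↦ boolSign (ε i))
      (Measure.pi fun _ ↦ μ) := integrable_weightedSup hgm hg' fun _ ↦ abs_boolSign_le _
  have hA₁ : Integrable (fun q : Fin n → Z × Z ↦ weightedSup g (fun i ↦ boolSign (ε i))
      fun i ↦ (q i).1) (Measure.pi fun _ ↦ μ.prod μ) := hfst.integrable_comp_of_integrable (hA ε)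
  have hA₂ : Integrable (fun q : Fin n → Z × Z ↦ weightedSup g (fun i ↦ boolSign (!ε i))
      fun i ↦ (q i).2) (Measure.pi fun _ ↦ μ.prod μ) :=
    hsnd.integrable_comp_of_integrable (hA fun i ↦ !ε i)
  rw [← hswap.integral_comp_of_measurable (hDm _),
    ← hfst.integral_comp_of_measurable (measurable_weightedSup hgm _),
    ← hsnd.integral_comp_of_measurable (measurable_weightedSup hgm _), ← integral_add hA₁ hA₂]
  refine integral_mono (integrable_of_measurable_of_abs_le ((hDm _).comp hswap.measurable)
    fun q ↦ abs_weightedSup_le hosc (by simp) _) (hA₁.add hA₂) fun q ↦ ciSup_le fun k ↦ ?_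
  refine le_trans (le_of_eq ?_) (add_le_add
    (weightedAverage_le_weightedSup hg' (fun i ↦ abs_boolSign_le (ε i)) (fun i ↦ (q i).1) k)
    (weightedAverage_le_weightedSup hg' (fun i ↦ abs_boolSign_le (!ε i)) (fun i ↦ (q i).2) k))
  rw [← mul_add, ← Finset.sum_add_distrib]
  congr 1
  refine Finset.sum_congr rfl fun i _ ↦ ?_
  cases hi : ε i <;> simp [boolSign, hi] <;> ring

/-- **Symmetrization**: the expected uniform deviation is at most twice the expected empirical
Rademacher complexity. -/
lemma integral_weightedSup_sub_le_two_mul (hgm : ∀ k, Measurable (g k))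
    (hg : ∀ k x, g k x ∈ Set.Icc (0 : ℝ) 1) :
    ∫ z, weightedSup (fun k x ↦ ∫ y, g k y ∂μ - g k x) (fun _ ↦ 1) z ∂(Measure.pi fun _ : Fin n ↦ μ)
      ≤ 2 * ∫ z, (1 / 2 ^ n) * ∑ ε : Fin n → Bool, weightedSup g (fun i ↦ boolSign (ε i)) z
          ∂(Measure.pi fun _ : Fin n ↦ μ) := by
  have hg' (k x) : |g k x| ≤ 1 := by
    rw [abs_of_nonneg (hg k x).1]; exact (hg k x).2
  refine (integral_weightedSup_sub_le_integral_ghost hgm hg).trans ?_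
  rw [integral_const_mul, integral_finsetSum _ fun ε _ ↦
    integrable_weightedSup hgm hg' fun i ↦ abs_boolSign_le (ε i)]
  set D := ∫ q, weightedSup (fun k (p : Z × Z) ↦ g k p.1 - g k p.2) (fun _ ↦ 1) q
    ∂(Measure.pi fun _ : Fin n ↦ μ.prod μ)
  have hsum := Finset.sum_le_sum fun ε (_ : ε ∈ (Finset.univ : Finset (Fin n → Bool))) ↦
    integral_ghost_le_add (μ := μ) hgm hg ε
  have hflip : ∑ ε : Fin n → Bool,
      ∫ z, weightedSup g (fun i ↦ boolSign (!ε i)) z ∂(Measure.pi fun _ ↦ μ)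
      = ∑ ε : Fin n → Bool, ∫ z, weightedSup g (fun i ↦ boolSign (ε i)) z ∂(Measure.pi fun _ ↦ μ) :=
    (Equiv.arrowCongr (.refl (Fin n)) Equiv.boolNot).sum_comp fun ε ↦
      ∫ z, weightedSup g (fun i ↦ boolSign (ε i)) z ∂(Measure.pi fun _ ↦ μ)
  rw [Finset.sum_add_distrib, hflip, Finset.sum_const, Finset.card_univ] at hsum
  simp only [Fintype.card_pi, Fintype.card_bool, Finset.prod_const, Finset.card_univ,
    Fintype.card_fin, nsmul_eq_mul, Nat.cast_pow, Nat.cast_ofNat] at hsum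
  rw [← mul_assoc, mul_one_div, div_mul_eq_mul_div, le_div_iff₀ (by positivity)]
  linarith

end symmetrization

/-- (Rademacher generalization bound.) For a nonempty countable
family `G` of measurable functions `g : Z → [0,1]` and any `δ ∈ (0,1)`, with
probability at least `1 - δ` over an i.i.d. sample `z = (z₁, …, zₙ) ∼ μ^⊗n`,
simultaneously for all `g ∈ G`:
`E[g] ≤ (1/n)·Σᵢ g(zᵢ) + 2·R̂(G(z)) + 3·√(log(2/δ)/(2n))`. -/
theorem rademacher_generalization_bound
    {Z : Type*} [MeasurableSpace Z] (μ : Measure Z) [IsProbabilityMeasure μ]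
    (n : ℕ) (hn : 1 ≤ n)
    (G : Set (Z → ℝ)) (hGne : G.Nonempty) (hGct : G.Countable)
    (hGmeas : ∀ g ∈ G, Measurable g)
    (hGrange : ∀ g ∈ G, ∀ z : Z, g z ∈ Set.Icc (0 : ℝ) 1)
    (δ : ℝ) (hδ : δ ∈ Set.Ioo (0 : ℝ) 1) :
    ENNReal.ofReal (1 - δ) ≤
      Measure.pi (fun _ : Fin n => μ)
        {z : Fin n → Z | ∀ g ∈ G,
          ∫ x, g x ∂μ ≤ (1 / (n : ℝ)) * ∑ i, g (z i)
            + 2 * empRad ((fun g : Z → ℝ => fun i : Fin n => g (z i)) '' G)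
            + 3 * Real.sqrt (Real.log (2 / δ) / (2 * n))} := by
  have : Countable G := hGct.to_subtype
  have : Nonempty G := hGne.to_subtype
  have hn' : (0 : ℝ) < n := by exact_mod_cast hn
  have hgm (g : G) : Measurable (g : Z → ℝ) := hGmeas g g.2
  have hg (g : G) (x : Z) : (g : Z → ℝ) x ∈ Set.Icc (0 : ℝ) 1 := hGrange g g.2 x
  have hg' (g : G) (x : Z) : |(g : Z → ℝ) x| ≤ 1 := by
    rw [abs_of_nonneg (hg g x).1]; exact (hg g x).2
  have hosc (g : G) (x y : Z) : |(g : Z → ℝ) x - (g : Z → ℝ) y| ≤ 1 :=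
    abs_sub_le_one_of_mem_Icc (hg g x) (hg g y)
  have hcen (g : G) (x : Z) : |∫ y, (g : Z → ℝ) y ∂μ - (g : Z → ℝ) x| ≤ 1 :=
    abs_sub_le_one_of_mem_Icc (integral_mem_Icc_of_forall_mem_Icc μ (hgm g) (hg g)) (hg g x)
  have hone : ∀ i : Fin n, |(fun _ ↦ 1 : Fin n → ℝ) i| ≤ 1 := by simp
  set P : Measure (Fin n → Z) := Measure.pi fun _ ↦ μ
  set Φ : (Fin n → Z) → ℝ :=
    weightedSup (fun (g : G) x ↦ ∫ y, (g : Z → ℝ) y ∂μ - (g : Z → ℝ) x) (fun _ ↦ 1)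
  set R : (Fin n → Z) → ℝ := fun z ↦ (1 / 2 ^ n) * ∑ ε : Fin n → Bool,
    weightedSup (fun g : G ↦ (g : Z → ℝ)) (fun i ↦ boolSign (ε i)) z with hR
  set t := Real.sqrt (Real.log (2 / δ) / (2 * n)) with ht
  have hΦm : Measurable Φ := measurable_weightedSup (fun g ↦ (hgm g).const_sub _) _
  have hRm : Measurable R :=
    (Finset.measurable_fun_sum _ fun ε _ ↦ measurable_weightedSup hgm _).const_mul _
  have hcard : ∑ _ε : Fin n → Bool, (1 : ℝ) = 2 ^ n := by simp
  have hRB (z) : |R z| ≤ 1 := by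
    rw [hR, abs_mul, abs_of_nonneg (by positivity : (0 : ℝ) ≤ 1 / 2 ^ n), one_div_mul_eq_div]
    refine div_le_one_of_le₀ ((Finset.abs_sum_le_sum_abs _ _).trans ?_) (by positivity)
    rw [← hcard]
    exact Finset.sum_le_sum fun ε _ ↦ abs_weightedSup_le hg' (fun i ↦ abs_boolSign_le (ε i)) z
  have hRd (z i y) : R (Function.update z i y) ≤ R z + 1 / n := by
    have hsum := Finset.sum_le_sum fun ε (_ : ε ∈ (Finset.univ : Finset (Fin n → Bool))) ↦
      weightedSup_update_le hg' hosc (fun i ↦ abs_boolSign_le (ε i)) z i y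
    calc R (Function.update z i y)
        ≤ (1 / 2 ^ n) * ∑ ε : Fin n → Bool, (weightedSup (fun g : G ↦ (g : Z → ℝ))
            (fun i ↦ boolSign (ε i)) z + 1 / n) :=
          mul_le_mul_of_nonneg_left hsum (by positivity)
      _ = R z + 1 / n := by simp [hR, Finset.sum_add_distrib, mul_add]
  have hexp : Real.exp (-2 * t ^ 2 / (n * (1 / n : ℝ) ^ 2)) = δ / 2 := by
    have hlog : 0 ≤ Real.log (2 / δ) :=
      Real.log_nonneg ((one_le_div hδ.1).mpr (by linarith [hδ.2]))
    rw [ht, Real.sq_sqrt (by positivity), ← inv_div 2 δ, ← Real.exp_log (div_pos two_pos hδ.1),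
      ← Real.exp_neg, Real.log_exp]
    congr 1
    field_simp
  have hΦt : P.real {z | t ≤ Φ z - ∫ w, Φ w ∂P} ≤ δ / 2 :=
    hexp ▸ measureReal_ge_le_of_boundedDifferences μ hΦm (abs_weightedSup_le hcen hone)
      (weightedSup_update_le hcen (fun g x y ↦ by simpa using hosc g y x) hone) (Real.sqrt_nonneg _)
  have hRt : P.real {z | t ≤ -R z - ∫ w, -R w ∂P} ≤ δ / 2 :=
    hexp ▸ measureReal_ge_le_of_boundedDifferences μ hRm.neg (by simpa using hRB)
      (fun z i y ↦ by
        have := hRd (Function.update z i y) i (z i)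
        simp only [Function.update_idem, Function.update_eq_self] at this
        simp only [Pi.neg_apply]
        linarith) (Real.sqrt_nonneg _)
  have hsymm : ∫ z, Φ z ∂P ≤ 2 * ∫ z, R z ∂P := integral_weightedSup_sub_le_two_mul hgm hg
  have hbad : P.real ({z | t ≤ Φ z - ∫ w, Φ w ∂P} ∪ {z | t ≤ -R z - ∫ w, -R w ∂P}) ≤ δ :=
    (measureReal_union_le _ _).trans (by linarith)
  have hmeas : MeasurableSet ({z | t ≤ Φ z - ∫ w, Φ w ∂P} ∪ {z | t ≤ -R z - ∫ w, -R w ∂P}) :=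
    (measurableSet_le measurable_const (hΦm.sub_const _)).union
      (measurableSet_le measurable_const (hRm.neg.sub_const _))
  refine le_trans ?_ (measure_mono (s := ({z | t ≤ Φ z - ∫ w, Φ w ∂P} ∪
    {z | t ≤ -R z - ∫ w, -R w ∂P})ᶜ) fun z hz g hgG ↦ ?_)
  · rw [← ofReal_measureReal, probReal_compl_eq_one_sub hmeas]
    exact ENNReal.ofReal_le_ofReal (by linarith)
  · simp only [Set.mem_compl_iff, Set.mem_union, Set.mem_ofPred_eq, not_or, not_le,
      integral_neg] at hz
    rw [empRad_image_eq]
    have hΦz := weightedAverage_le_weightedSup hcen hone z ⟨g, hgG⟩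
    have havg : (1 / (n : ℝ)) * ∑ i, 1 * (∫ y, g y ∂μ - g (z i))
        = ∫ y, g y ∂μ - (1 / (n : ℝ)) * ∑ i, g (z i) := by
      simp [Finset.sum_sub_distrib, mul_sub, hn'.ne']
    change (1 / (n : ℝ)) * ∑ i, 1 * (∫ y, g y ∂μ - g (z i)) ≤ Φ z at hΦz
    change _ ≤ _ + 2 * R z + _
    linarith [hz.1, hz.2]
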